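/- Let u = x_i x_j > v = x_r x_s (i < j, r < s) be squarefree monomials of degree 2 in k[x₁,…,xₙ], let Δ be the simplicial complex on [n] with I_Δ = (L(u,v)), let Δ₁ be the full simplex on {1,…,i−1}, let Δ₂ be the complex of the ideal generated by L(u,v) in k[x_i,…,xₙ], and let t ≥ 2. Assume Δ is not CM_{t−1} over k. Then Δ is CM_t over k if and only if Δ₁ has dimension t − 2 (i.e., i = t) and Δ₂ is Buchsbaum over k. -/

import Mathlib

open Finset

/-- An abstract simplicial complex on the vertex type `V`: a collection of
finite subsets of `V` (the faces) closed under passing to subsets. -/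
structure SComplex (V : Type*) where
  faces : Set (Finset V)
  down_closed : ∀ ⦃F G : Finset V⦄, F ∈ faces → G ⊆ F → G ∈ faces

namespace SComplex

variable {V : Type*} [DecidableEq V]

/-- The vertex set of a simplicial complex. -/
def vertexSet (Δ : SComplex V) : Set V := {v | {v} ∈ Δ.faces}

/-- A facet is a maximal face. -/
def IsFacet (Δ : SComplex V) (F : Finset V) : Prop :=
  F ∈ Δ.faces ∧ ∀ G ∈ Δ.faces, F ⊆ G → F = G

/-- A complex is pure if all of its facets have the same dimension (cardinality). -/
def Pure (Δ : SComplex V) : Prop :=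
  ∀ ⦃F G⦄, Δ.IsFacet F → Δ.IsFacet G → F.card = G.card

/-- One more than the dimension: the largest cardinality of a face of `Δ`.
So `Δ.dimSucc = d` means `Δ` has dimension `d - 1`. -/
noncomputable def dimSucc (Δ : SComplex V) : ℕ :=
  sSup {n | ∃ F ∈ Δ.faces, F.card = n}

/-- The link of a face `F` : `link Δ F = {G ∈ Δ : G ∪ F ∈ Δ, G ∩ F = ∅}`. -/
def link (Δ : SComplex V) (F : Finset V) : SComplex V where
  faces := {G | G ∈ Δ.faces ∧ Disjoint G F ∧ G ∪ F ∈ Δ.faces}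
  down_closed := by
    rintro G H ⟨hG, hdis, hGF⟩ hHG
    exact ⟨Δ.down_closed hG hHG, Finset.disjoint_of_subset_left hHG hdis,
      Δ.down_closed hGF (Finset.union_subset_union_left hHG)⟩

/-- A complex is connected if it has a vertex and any two vertices are joined
by a path of edges (connectivity of the 1-skeleton). -/
def Connected (Δ : SComplex V) : Prop :=
  (∃ v, {v} ∈ Δ.faces) ∧
    ∀ a b : V, {a} ∈ Δ.faces → {b} ∈ Δ.faces →
      Relation.ReflTransGen (fun x y => x ≠ y ∧ ({x, y} : Finset V) ∈ Δ.faces) a b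

/-- The join of two simplicial complexes (on disjoint vertex sets):
`Δ₁ ∗ Δ₂ = {F ∪ G : F ∈ Δ₁, G ∈ Δ₂}`. -/
def join (Δ₁ Δ₂ : SComplex V) : SComplex V where
  faces := {H | ∃ F ∈ Δ₁.faces, ∃ G ∈ Δ₂.faces, H = F ∪ G}
  down_closed := by
    rintro H H' ⟨F, hF, G, hG, rfl⟩ hsub
    refine ⟨H' ∩ F, Δ₁.down_closed hF inter_subset_right,
      H' \ F, Δ₂.down_closed hG ?_, ?_⟩
    · intro x hx
      rcases Finset.mem_sdiff.mp hx with ⟨hx1, hx2⟩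
      rcases Finset.mem_union.mp (hsub hx1) with h | h
      · exact absurd h hx2
      · exact h
    · ext x
      by_cases hx : x ∈ F <;>
        simp only [Finset.mem_union, Finset.mem_inter, Finset.mem_sdiff, hx] <;> tauto

/-- The full simplex on a finite vertex set `W`. -/
def simplexOn (W : Finset V) : SComplex V :=
  ⟨{F | F ⊆ W}, fun _ _ hF hG => hG.trans hF⟩

/-- A shelling of `Δ`: an ordering `l` of all the facets of `Δ` such that each
facet meets the union of the previous ones in a nonempty union of
codimension-one faces of it. -/
def IsShelling (Δ : SComplex V) (l : List (Finset V)) : Prop :=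
  l.Nodup ∧ (∀ F, F ∈ l ↔ Δ.IsFacet F) ∧
    ∀ i j : ℕ, j < i → i < l.length →
      ∃ m, m < i ∧ ∃ v ∈ l[i]!,
        l[i]! ∩ l[j]! ⊆ l[i]! ∩ l[m]! ∧ l[i]! ∩ l[m]! = l[i]!.erase v

/-- A complex is shellable if its facets admit a shelling order. -/
def Shellable (Δ : SComplex V) : Prop := ∃ l, IsShelling Δ l

/-- The reduced homology `H̃₀(Δ; k)` vanishes: every `k`-linear combination of
vertices of `Δ` with coefficient sum zero is a `k`-linear combination of
boundaries of edges of `Δ`. -/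
def ReducedH0Vanishes (k : Type*) [Field k] (Δ : SComplex V) : Prop :=
  ∀ f : V →₀ k, (∀ v ∈ f.support, {v} ∈ Δ.faces) → (f.sum fun _ c => c) = 0 →
    f ∈ Submodule.span k {g : V →₀ k | ∃ a b : V, a ≠ b ∧ ({a, b} : Finset V) ∈ Δ.faces ∧
      g = Finsupp.single a 1 - Finsupp.single b 1}

end SComplex

/-- A commutative ring satisfies Serre's condition `S₂` if for every prime `p`
the localization at `p` contains, inside its maximal ideal, a regular sequence
of length at least `min 2 (dim R_p)`. -/
def RingSerreS2 (R : Type*) [CommRing R] : Prop :=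
  ∀ (p : Ideal R) [p.IsPrime],
    ∃ rs : List (Localization.AtPrime p),
      (∀ r ∈ rs, r ∈ IsLocalRing.maximalIdeal (Localization.AtPrime p)) ∧
      RingTheory.Sequence.IsRegular (Localization.AtPrime p) rs ∧
      min 2 (ringKrullDim (Localization.AtPrime p)) ≤ (rs.length : WithBot ℕ∞)

section GroundSet

/-- The squarefree monomial `∏_{i ∈ S} xᵢ` in the polynomial ring whose
variables are indexed by the ground set `W ⊆ ℕ`. -/
noncomputable def monoW (k : Type*) [CommRing k] (W S : Finset ℕ) :
    MvPolynomial {x // x ∈ W} k :=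
  ∏ i ∈ S.subtype (· ∈ W), MvPolynomial.X i

/-- The Stanley–Reisner ideal of a complex `Δ` with ground (vertex) set `W ⊆ ℕ`,
inside the polynomial ring `k[xᵢ : i ∈ W]`: it is generated by the squarefree
monomials of the non-faces contained in `W`. -/
noncomputable def srIdealW (k : Type*) [CommRing k] (W : Finset ℕ) (Δ : SComplex ℕ) :
    Ideal (MvPolynomial {x // x ∈ W} k) :=
  Ideal.span {p | ∃ F : Finset ℕ, F ⊆ W ∧ F ∉ Δ.faces ∧ p = monoW k W F}

/-- The Stanley–Reisner ring `k[Δ]` of a complex with ground set `W ⊆ ℕ`. -/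
abbrev srRingW (k : Type*) [CommRing k] (W : Finset ℕ) (Δ : SComplex ℕ) :=
  MvPolynomial {x // x ∈ W} k ⧸ srIdealW k W Δ

/-- The irrelevant maximal ideal of the Stanley–Reisner ring. -/
noncomputable def srIrrelevantW (k : Type*) [CommRing k] (W : Finset ℕ)
    (Δ : SComplex ℕ) : Ideal (srRingW k W Δ) :=
  (Ideal.span (Set.range (MvPolynomial.X : {x // x ∈ W} → MvPolynomial {x // x ∈ W} k))).map
    (Ideal.Quotient.mk (srIdealW k W Δ))

/-- `Δ` (a complex with ground set `W ⊆ ℕ`) is Cohen–Macaulay over the field `k`: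
the ring `k[Δ]` admits a regular sequence, inside the irrelevant maximal ideal,
whose length equals the Krull dimension of `k[Δ]`. -/
def IsCMW (k : Type*) [Field k] (W : Finset ℕ) (Δ : SComplex ℕ) : Prop :=
  ∃ rs : List (srRingW k W Δ), (∀ r ∈ rs, r ∈ srIrrelevantW k W Δ) ∧
    RingTheory.Sequence.IsRegular (srRingW k W Δ) rs ∧
    ringKrullDim (srRingW k W Δ) = (rs.length : WithBot ℕ∞)

/-- `Δ` is `CM_t` (Cohen–Macaulay in codimension `t`) over `k`: `Δ` is pure and
`link_Δ(F)` is Cohen–Macaulay over `k` for every face `F` with `#F ≥ t`.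
`CM_1` is the Buchsbaum property. -/
def IsCMtW (k : Type*) [Field k] (W : Finset ℕ) (t : ℕ) (Δ : SComplex ℕ) : Prop :=
  Δ.Pure ∧ ∀ F ∈ Δ.faces, t ≤ F.card → IsCMW k W (Δ.link F)

end GroundSet

section Lex

/-- Comparison of squarefree monomials of the same degree in the lexicographic
order with `x₁ > x₂ > ⋯ > xₙ`, the monomials being identified with their
supports: `u >_lex v` iff the smallest variable index where they differ
belongs to `u`. -/
def lexGT (A B : Finset ℕ) : Prop :=
  ∃ m ∈ A, m ∉ B ∧ ∀ x < m, (x ∈ A ↔ x ∈ B)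

/-- `u ≥_lex v` for squarefree monomials identified with their supports. -/
def lexGE (A B : Finset ℕ) : Prop := A = B ∨ lexGT A B

/-- The lexsegment `L(u,v)` of squarefree monomials of degree `d` in
`x₁, …, xₙ`, the monomials being identified with their supports:
all `S ⊆ [n] = {1, …, n}` with `#S = d` and `u ≥_lex S ≥_lex v`. -/
def lexSegment (n d : ℕ) (U V₀ : Finset ℕ) : Set (Finset ℕ) :=
  {S | S ⊆ Finset.Icc 1 n ∧ S.card = d ∧ lexGE U S ∧ lexGE S V₀}

/-- The ideal of `k[xᵢ : i ∈ W]` generated by the squarefree monomials of the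
lexsegment `L(u,v)` (of degree-`d` squarefree monomials in `x₁, …, xₙ`). -/
noncomputable def lexIdealW (k : Type*) [CommRing k] (W : Finset ℕ) (n d : ℕ)
    (U V₀ : Finset ℕ) : Ideal (MvPolynomial {x // x ∈ W} k) :=
  Ideal.span {p | ∃ S ∈ lexSegment n d U V₀, p = monoW k W S}

end Lex

section RegularSystem

open Polynomial RingTheory.Sequence
open scoped Pointwise

/-- There is a regular sequence inside the ideal `m` of length equal to the Krull dimension. -/
def HasFullRegularSequence (R : Type*) [CommRing R] (m : Ideal R) : Prop :=
  ∃ rs : List R, (∀ r ∈ rs, r ∈ m) ∧ IsRegular R rs ∧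
    ringKrullDim R = (rs.length : WithBot ℕ∞)

theorem ringKrullDim_le_of_isIntegral (R S : Type*) [CommRing R] [CommRing S] [Algebra R S]
    [Algebra.IsIntegral R S] : ringKrullDim S ≤ ringKrullDim R := by
  refine Order.krullDim_le_of_strictMono (PrimeSpectrum.comap (algebraMap R S)) ?_
  intro I J hIJ
  obtain ⟨x, hxJ, hxI⟩ := SetLike.exists_of_lt (show I.asIdeal < J.asIdeal from hIJ)
  exact Ideal.comap_lt_comap_of_integral_mem_sdiff (show I.asIdeal ≤ J.asIdeal from hIJ.le)
    ⟨hxJ, hxI⟩ (Algebra.IsIntegral.isIntegral x)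

namespace HasFullRegularSequence

theorem of_ringEquiv {R S : Type*} [CommRing R] [CommRing S] (e : R ≃+* S) {m : Ideal R}
    {m' : Ideal S} (hm : ∀ r ∈ m, e r ∈ m') (h : HasFullRegularSequence R m) :
    HasFullRegularSequence S m' := by
  obtain ⟨rs, hrs, hreg, hdim⟩ := h
  refine ⟨rs.map e, ?_, ?_, ?_⟩
  · simpa using fun r hr => hm r (hrs r hr)
  · refine (AddEquiv.isRegular_congr (e := e.toAddEquiv) ?_).mp hreg
    exact List.forall₂_map_right_iff.mpr (List.forall₂_same.mpr fun r _ x => by simp)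
  · rw [← ringKrullDim_eq_of_ringEquiv e, hdim, List.length_map]

theorem polynomial {R : Type*} [CommRing R] [IsNoetherianRing R] {m : Ideal R} {m' : Ideal R[X]}
    (hX : X ∈ m') (hm : ∀ r ∈ m, C r ∈ m') (h : HasFullRegularSequence R m) :
    HasFullRegularSequence R[X] m' := by
  obtain ⟨rs, hrs, hreg, hdim⟩ := h
  refine ⟨X :: rs.map C, ?_, ?_, ?_⟩
  · simpa [hX] using fun r hr => hm r (hrs r hr)
  · rw [isRegular_cons_iff]
    refine ⟨fun p q hpq => ?_, ?_⟩
    · exact (Polynomial.isRegular_X (R := R)).left hpq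
    · let f : R[X] →ₛₗ[Polynomial.constantCoeff (R := R)] R :=
        { toFun := Polynomial.constantCoeff
          map_add' := map_add _
          map_smul' := fun p q => by simp }
      have hker : LinearMap.ker f = (X : R[X]) • (⊤ : Submodule R[X] R[X]) := by
        ext p
        rw [Submodule.mem_smul_pointwise_iff_exists]
        simp only [LinearMap.mem_ker, Submodule.mem_top, true_and, smul_eq_mul]
        change p.coeff 0 = 0 ↔ _
        rw [← Polynomial.X_dvd_iff]
        exact ⟨fun ⟨q, hq⟩ => ⟨q, hq.symm⟩, fun ⟨q, hq⟩ => ⟨q, hq.symm⟩⟩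
      let f' : QuotSMulTop (X : R[X]) R[X] →ₛₗ[Polynomial.constantCoeff (R := R)] R :=
        Submodule.liftQ _ f hker.ge
      have hf' : Function.Bijective f' := by
        refine ⟨LinearMap.ker_eq_bot.mp (Submodule.ker_liftQ_eq_bot _ _ _ hker.le), fun r => ?_⟩
        exact ⟨Submodule.Quotient.mk (C r), coeff_C_zero⟩
      let g : QuotSMulTop (X : R[X]) R[X] ≃+ R := AddEquiv.ofBijective f' hf'
      refine (AddEquiv.isRegular_congr (e := g) ?_).mpr hreg
      refine List.forall₂_map_left_iff.mpr (List.forall₂_same.mpr fun r _ x => ?_)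
      change f' (C r • x) = r • f' x
      simp [map_smulₛₗ]
  · rw [Polynomial.ringKrullDim_of_isNoetherianRing, hdim]
    simp

theorem of_free {R S : Type*} [CommRing R] [CommRing S] [Algebra R S] [Nontrivial S]
    [Module.Free R S] [Module.Finite R S] (g : S →+* R) (hg : Function.Surjective g)
    {m : Ideal R} {m' : Ideal S} (hm : ∀ r ∈ m, algebraMap R S r ∈ m')
    (h : HasFullRegularSequence R m) : HasFullRegularSequence S m' := by
  obtain ⟨rs, hrs, hreg, hdim⟩ := h
  refine ⟨rs.map (algebraMap R S), ?_, hreg.of_faithfullyFlat, ?_⟩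
  · simpa using fun r hr => hm r (hrs r hr)
  · rw [List.length_map, ← hdim]
    exact le_antisymm (ringKrullDim_le_of_isIntegral R S) (ringKrullDim_le_of_surjective g hg)

theorem of_isField {R : Type*} [CommRing R] (hR : IsField R) (m : Ideal R) :
    HasFullRegularSequence R m := by
  have := hR.nontrivial
  exact ⟨[], by simp, IsRegular.nil R R, by simpa using ringKrullDim_eq_zero_of_isField hR⟩

end HasFullRegularSequence

/-- The tuples of polynomials that share their constant term. -/
def sharedConstant (A : Type*) [CommRing A] (ι : Type*) : Subalgebra A[X] (ι → A[X]) where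
  carrier := {f | ∀ a b, (f a).coeff 0 = (f b).coeff 0}
  mul_mem' := fun {f g} hf hg a b => by simp [mul_coeff_zero, hf a b, hg a b]
  add_mem' := fun {f g} hf hg a b => by simp [hf a b, hg a b]
  algebraMap_mem' := fun _ _ _ => rfl

section sharedConstant

variable {A : Type*} [CommRing A] {ι : Type*}

/-- A tuple of polynomials with a shared constant term is determined by its entry at a base point
together with the differences to that entry, divided by the variable. -/
noncomputable def sharedConstantEquiv [DecidableEq ι] (o : ι) :
    sharedConstant A ι ≃ₗ[A[X]] A[X] × ({i // i ≠ o} → A[X]) :=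
  LinearEquiv.symm
  { toFun := fun p => ⟨fun i => if h : i = o then p.1 else p.1 + X * p.2 ⟨i, h⟩, by
      have key : ∀ a, (if h : a = o then p.1 else p.1 + X * p.2 ⟨a, h⟩).coeff 0 = p.1.coeff 0 := by
        intro a
        split_ifs <;> simp
      intro a b
      simp only [key]⟩
    map_add' := fun p q => by
      ext1; funext i
      by_cases h : i = o <;> simp [h]; ring
    map_smul' := fun c p => by
      ext1; funext i
      by_cases h : i = o <;> simp [h]; ring
    invFun := fun f => (f.1 o, fun i => (f.1 i - f.1 o).divX)
    left_inv := fun p => by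
      ext1
      · simp
      · funext i
        have : X * p.2 i = p.2 i * X := mul_comm _ _
        ext c
        simp [i.2, this, coeff_divX]
    right_inv := fun f => by
      ext1; funext i
      by_cases h : i = o
      · simp [h]
      · have h1 := Polynomial.divX_mul_X_add (f.1 i - f.1 o)
        have h2 : (f.1 i - f.1 o).coeff 0 = 0 := by simp [f.2 i o]
        rw [h2, C_0, add_zero, mul_comm] at h1
        simp only [h, dite_false, h1]
        ring }

/-- The constant tuples of constant polynomials. -/
noncomputable def constantTuple (A : Type*) [CommRing A] (ι : Type*) : A →+* sharedConstant A ι :=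
  (algebraMap A[X] (sharedConstant A ι)).comp C

/-- The constant tuple of the variable. -/
noncomputable def variableTuple (A : Type*) [CommRing A] (ι : Type*) : sharedConstant A ι :=
  algebraMap A[X] (sharedConstant A ι) X

theorem HasFullRegularSequence.sharedConstant [Finite ι] [IsNoetherianRing A] (o : ι)
    {m : Ideal A} {m' : Ideal (sharedConstant A ι)}
    (hX : variableTuple A ι ∈ m')
    (hm : ∀ r ∈ m, constantTuple A ι r ∈ m')
    (h : HasFullRegularSequence A m) :
    HasFullRegularSequence (_root_.sharedConstant A ι) m' := by
  classical
  have : Nontrivial A := h.choose_spec.2.1.nontrivial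
  have e := sharedConstantEquiv (A := A) o
  have : Module.Free A[X] (_root_.sharedConstant A ι) := Module.Free.of_equiv e.symm
  have : Module.Finite A[X] (_root_.sharedConstant A ι) := Module.Finite.equiv e.symm
  have : Nontrivial (_root_.sharedConstant A ι) := e.symm.injective.nontrivial
  let g : _root_.sharedConstant A ι →+* A[X] :=
    (Pi.evalRingHom (fun _ => A[X]) o).comp (_root_.sharedConstant A ι).val.toRingHom
  exact (h.polynomial (m' := m'.comap (algebraMap A[X] _)) hX hm).of_free g
    (fun p => ⟨algebraMap _ _ p, rfl⟩) (fun r hr => hr)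

end sharedConstant

end RegularSystem

section StanleyReisner

open MvPolynomial

/-- The support of an exponent vector, as a set of natural numbers. -/
def exponentSupport {W : Finset ℕ} (e : {x // x ∈ W} →₀ ℕ) : Finset ℕ :=
  e.support.map (Function.Embedding.subtype _)

theorem mem_exponentSupport {W : Finset ℕ} {e : {x // x ∈ W} →₀ ℕ} {a : ℕ} :
    a ∈ exponentSupport e ↔ ∃ h : a ∈ W, e ⟨a, h⟩ ≠ 0 := by
  simp [exponentSupport]

theorem exponentSupport_subset {W : Finset ℕ} (e : {x // x ∈ W} →₀ ℕ) :
    exponentSupport e ⊆ W := fun _ ha => (mem_exponentSupport.mp ha).1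

/-- The exponent vector of the squarefree monomial `monoW k W S`. -/
noncomputable def squarefreeExponent (W S : Finset ℕ) : {x // x ∈ W} →₀ ℕ :=
  ∑ i ∈ S.subtype (· ∈ W), Finsupp.single i 1

theorem squarefreeExponent_apply (W S : Finset ℕ) (w : {x // x ∈ W}) :
    squarefreeExponent W S w = if w.1 ∈ S then 1 else 0 := by
  classical
  simp [squarefreeExponent, Finsupp.finsetSum_apply, Finsupp.single_apply]

theorem monoW_eq_monomial (k : Type*) [CommRing k] (W S : Finset ℕ) :
    monoW k W S = monomial (squarefreeExponent W S) 1 := by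
  rw [squarefreeExponent, monomial_sum_one]
  rfl

theorem squarefreeExponent_le_iff {W S : Finset ℕ} {e : {x // x ∈ W} →₀ ℕ} :
    squarefreeExponent W S ≤ e ↔ S ∩ W ⊆ exponentSupport e := by
  constructor
  · intro h a ha
    rw [Finset.mem_inter] at ha
    have := h ⟨a, ha.2⟩
    rw [squarefreeExponent_apply, if_pos ha.1] at this
    exact mem_exponentSupport.mpr ⟨ha.2, by omega⟩
  · intro h w
    rw [squarefreeExponent_apply]
    split_ifs with hw
    · obtain ⟨_, h'⟩ := mem_exponentSupport.mp (h (Finset.mem_inter.mpr ⟨hw, w.2⟩))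
      exact Nat.one_le_iff_ne_zero.mpr h'
    · exact Nat.zero_le _

theorem exponentSupport_squarefreeExponent (W S : Finset ℕ) :
    exponentSupport (squarefreeExponent W S) = S ∩ W := by
  ext a
  simp [mem_exponentSupport, squarefreeExponent_apply, and_comm]

theorem mem_span_monoW_iff (k : Type*) [CommRing k] (W : Finset ℕ) (𝒮 : Set (Finset ℕ))
    (f : MvPolynomial {x // x ∈ W} k) :
    f ∈ Ideal.span {p | ∃ S ∈ 𝒮, p = monoW k W S} ↔
      ∀ e ∈ f.support, ∃ S ∈ 𝒮, S ∩ W ⊆ exponentSupport e := by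
  have : {p | ∃ S ∈ 𝒮, p = monoW k W S} =
      (fun s => monomial s (1 : k)) '' (squarefreeExponent W '' 𝒮) := by
    ext p
    simp [monoW_eq_monomial, eq_comm]
  rw [this, mem_ideal_span_monomial_image]
  simp [squarefreeExponent_le_iff]

theorem monoW_mem_span_monoW_iff (k : Type*) [CommRing k] [Nontrivial k] (W : Finset ℕ)
    (𝒮 : Set (Finset ℕ)) (F : Finset ℕ) :
    monoW k W F ∈ Ideal.span {p | ∃ S ∈ 𝒮, p = monoW k W S} ↔
      ∃ S ∈ 𝒮, S ∩ W ⊆ F ∩ W := by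
  classical
  rw [mem_span_monoW_iff, monoW_eq_monomial, support_monomial, if_neg one_ne_zero]
  simp [exponentSupport_squarefreeExponent]

theorem mem_srIdealW_iff {k : Type*} [CommRing k] {W : Finset ℕ} {Δ : SComplex ℕ}
    {f : MvPolynomial {x // x ∈ W} k} :
    f ∈ srIdealW k W Δ ↔ ∀ e ∈ f.support, exponentSupport e ∉ Δ.faces := by
  have := mem_span_monoW_iff k W {F | F ⊆ W ∧ F ∉ Δ.faces} f
  simp only [Set.mem_ofPred_eq, and_assoc] at this
  rw [srIdealW, this]
  refine forall₂_congr fun e _ => ⟨?_, fun h => ⟨_, exponentSupport_subset e, h, ?_⟩⟩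
  · rintro ⟨S, hSW, hS, hSe⟩ he
    exact hS (Δ.down_closed he (by rwa [Finset.inter_eq_left.mpr hSW] at hSe))
  · exact Finset.inter_subset_left

theorem monoW_mem_srIdealW_iff {k : Type*} [CommRing k] [Nontrivial k] {W F : Finset ℕ}
    (hF : F ⊆ W) {Δ : SComplex ℕ} : monoW k W F ∈ srIdealW k W Δ ↔ F ∉ Δ.faces := by
  classical
  rw [mem_srIdealW_iff, monoW_eq_monomial, support_monomial, if_neg one_ne_zero]
  simp [exponentSupport_squarefreeExponent, Finset.inter_eq_left.mpr hF]

theorem X_mem_srIdealW {k : Type*} [CommRing k] {W : Finset ℕ} {Δ : SComplex ℕ}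
    {w : {x // x ∈ W}} (hw : {w.1} ∉ Δ.faces) : X w ∈ srIdealW k W Δ := by
  refine Ideal.subset_span ⟨{w.1}, by simp [w.2], hw, ?_⟩
  rw [monoW, show Finset.subtype (· ∈ W) {w.1} = {w} by
    ext a
    rw [Finset.mem_subtype, Finset.mem_singleton, Finset.mem_singleton, Subtype.ext_iff],
    Finset.prod_singleton]

theorem mk_X_mem_srIrrelevantW (k : Type*) [CommRing k] (W : Finset ℕ) (Δ : SComplex ℕ)
    (w : {x // x ∈ W}) : Ideal.Quotient.mk (srIdealW k W Δ) (X w) ∈ srIrrelevantW k W Δ :=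
  Ideal.mem_map_of_mem _ (Ideal.subset_span ⟨w, rfl⟩)

theorem isCMW_of_faces_eq_singleton_empty (k : Type*) [Field k] (W : Finset ℕ) {Δ : SComplex ℕ}
    (hΔ : ∀ F, F ∈ Δ.faces ↔ F = ∅) : IsCMW k W Δ := by
  have hker : srIdealW k W Δ = RingHom.ker (constantCoeff (R := k) (σ := {x // x ∈ W})) := by
    ext f
    rw [mem_srIdealW_iff, RingHom.mem_ker, constantCoeff_eq]
    simp only [hΔ, exponentSupport, Finset.map_eq_empty, Finsupp.support_eq_empty]
    refine ⟨fun h => ?_, fun h e he h0 => ?_⟩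
    · by_contra h0
      exact h 0 (mem_support_iff.mpr h0) rfl
    · rw [h0, mem_support_iff] at he
      exact he h
  have hsurj : Function.Surjective (constantCoeff (R := k) (σ := {x // x ∈ W})) :=
    fun r => ⟨C r, constantCoeff_C _ r⟩
  let e : srRingW k W Δ ≃+* k :=
    (Ideal.quotEquivOfEq hker).trans (RingHom.quotientKerEquivOfSurjective hsurj)
  exact HasFullRegularSequence.of_isField (e.toMulEquiv.isField (Field.toIsField k)) _

/-- The substitution of zero for the variables with index in `Q`. -/
noncomputable def zeroVars (k : Type*) [CommRing k] (W Q : Finset ℕ) :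
    MvPolynomial {x // x ∈ W} k →ₐ[k] MvPolynomial {x // x ∈ W} k :=
  aeval fun w => if w.1 ∈ Q then 0 else X w

theorem zeroVars_monomial {k : Type*} [CommRing k] {W Q : Finset ℕ} (e : {x // x ∈ W} →₀ ℕ)
    (a : k) : zeroVars k W Q (monomial e a) =
      if Disjoint (exponentSupport e) Q then monomial e a else 0 := by
  rw [zeroVars, aeval_monomial]
  split_ifs with h
  · rw [monomial_eq]
    congr 1
    refine Finsupp.prod_congr fun w hw => ?_
    rw [if_neg]
    refine Finset.disjoint_left.mp h (mem_exponentSupport.mpr ⟨w.2, ?_⟩)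
    exact Finsupp.mem_support_iff.mp hw
  · obtain ⟨a, ha, haQ⟩ := Finset.not_disjoint_iff.mp h
    obtain ⟨haW, ha⟩ := mem_exponentSupport.mp ha
    rw [Finsupp.prod, Finset.prod_eq_zero (Finsupp.mem_support_iff.mpr ha), mul_zero]
    rw [if_pos haQ, zero_pow ha]

theorem coeff_zeroVars {k : Type*} [CommRing k] {W Q : Finset ℕ} (e : {x // x ∈ W} →₀ ℕ)
    (f : MvPolynomial {x // x ∈ W} k) : coeff e (zeroVars k W Q f) =
      if Disjoint (exponentSupport e) Q then coeff e f else 0 := by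
  classical
  induction f using MvPolynomial.induction_on' with
  | monomial d a =>
    rw [zeroVars_monomial]
    by_cases hde : d = e
    · subst hde
      split_ifs <;> simp
    · split_ifs <;> simp [hde]
  | add p q hp hq =>
    rw [map_add, coeff_add, hp, hq]
    split_ifs <;> simp

end StanleyReisner

section JoinPoints

open MvPolynomial

variable (k : Type*) [Field k] (W P : Finset ℕ) (Γ : SComplex ℕ)

/-- The image of a variable in the component of the point `p` of a join with the points of `P`. -/
noncomputable def pointVar (p : {x // x ∈ P}) (w : {x // x ∈ W}) :
    Polynomial (srRingW k W Γ) :=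
  if w.1 ∈ P then (if w.1 = p.1 then Polynomial.X else 0)
  else Polynomial.C (Ideal.Quotient.mk (srIdealW k W Γ) (X w))

/-- The map from the polynomial ring to the component of the point `p`. -/
noncomputable def pointHom (p : {x // x ∈ P}) :
    MvPolynomial {x // x ∈ W} k →ₐ[k] Polynomial (srRingW k W Γ) :=
  aeval (pointVar k W P Γ p)

theorem coeff_zero_pointHom (p q : {x // x ∈ P}) (f : MvPolynomial {x // x ∈ W} k) :
    (pointHom k W P Γ p f).coeff 0 = (pointHom k W P Γ q f).coeff 0 := by
  suffices h : (Polynomial.constantCoeff.comp (pointHom k W P Γ p).toRingHom) =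
      Polynomial.constantCoeff.comp (pointHom k W P Γ q).toRingHom from DFunLike.congr_fun h f
  refine MvPolynomial.ringHom_ext (fun r => ?_) fun w => ?_
  · simp [← MvPolynomial.algebraMap_eq]
  · simp only [pointHom, pointVar, AlgHom.toRingHom_eq_coe, RingHom.coe_comp, RingHom.coe_coe,
      Function.comp_apply, aeval_X]
    split_ifs <;> simp

/-- All the components together, as a map to the tuples with a shared constant term. -/
noncomputable def pointsHom :
    MvPolynomial {x // x ∈ W} k →+* sharedConstant (srRingW k W Γ) {x // x ∈ P} :=
  (RingHom.pi fun p => (pointHom k W P Γ p).toRingHom).codRestrict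
    (sharedConstant (srRingW k W Γ) {x // x ∈ P})
    fun f p q => coeff_zero_pointHom k W P Γ p q f

variable {k W P Γ}

theorem pointsHom_apply (f : MvPolynomial {x // x ∈ W} k) (p : {x // x ∈ P}) :
    (pointsHom k W P Γ f).1 p = pointHom k W P Γ p f := rfl

theorem pointsHom_X_of_notMem {w : {x // x ∈ W}} (hw : w.1 ∉ P) :
    pointsHom k W P Γ (X w) =
      constantTuple (srRingW k W Γ) {x // x ∈ P} (Ideal.Quotient.mk (srIdealW k W Γ) (X w)) := by
  ext1
  funext p
  rw [pointsHom_apply, pointHom, aeval_X, pointVar, if_neg hw]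
  rfl

theorem exists_pointsHom_eq_constantTuple (hΓ : ∀ F ∈ Γ.faces, Disjoint F P)
    (a : srRingW k W Γ) : ∃ f, pointsHom k W P Γ f =
      constantTuple (srRingW k W Γ) {x // x ∈ P} a := by
  obtain ⟨g, rfl⟩ := Ideal.Quotient.mk_surjective a
  induction g using MvPolynomial.induction_on with
  | C r =>
    refine ⟨C r, ?_⟩
    ext1
    funext p
    rw [pointsHom_apply, ← MvPolynomial.algebraMap_eq, AlgHom.commutes]
    rfl
  | add f g hf hg =>
    obtain ⟨f', hf'⟩ := hf
    obtain ⟨g', hg'⟩ := hg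
    exact ⟨f' + g', by simp only [map_add, hf', hg']⟩
  | mul_X f w hf =>
    obtain ⟨f', hf'⟩ := hf
    by_cases hw : w.1 ∈ P
    · refine ⟨0, ?_⟩
      have : {w.1} ∉ Γ.faces := fun h => by simpa [hw] using hΓ _ h
      rw [map_mul, Ideal.Quotient.eq_zero_iff_mem.mpr (X_mem_srIdealW this)]
      simp
    · exact ⟨f' * X w, by simp only [map_mul, hf', pointsHom_X_of_notMem hw]⟩

theorem pointsHom_X_of_mem (hPW : P ⊆ W) (p : {x // x ∈ P}) :
    (pointsHom k W P Γ (X ⟨p.1, hPW p.2⟩)).1 = Pi.single p Polynomial.X := by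
  funext q
  rw [pointsHom_apply, pointHom, aeval_X, pointVar, if_pos p.2, Pi.single_apply]
  exact if_congr ⟨fun h => Subtype.ext h.symm, fun h => congrArg Subtype.val h.symm⟩ rfl rfl

theorem pointsHom_surjective (hPW : P ⊆ W) (o : {x // x ∈ P})
    (hΓ : ∀ F ∈ Γ.faces, Disjoint F P) : Function.Surjective (pointsHom k W P Γ) := by
  have hsingle : ∀ (p : {x // x ∈ P}) (q : Polynomial (srRingW k W Γ)),
      ∃ f, (pointsHom k W P Γ f).1 = Pi.single p (Polynomial.X * q) := by
    intro p q
    induction q using Polynomial.induction_on with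
    | C a =>
      obtain ⟨f, hf⟩ := exists_pointsHom_eq_constantTuple hΓ a
      refine ⟨X ⟨p.1, hPW p.2⟩ * f, ?_⟩
      rw [map_mul, hf, MulMemClass.coe_mul, pointsHom_X_of_mem]
      exact (Pi.single_mul_left _).symm
    | add a b ha hb =>
      obtain ⟨f, hf⟩ := ha
      obtain ⟨g, hg⟩ := hb
      exact ⟨f + g, by rw [map_add, AddMemClass.coe_add, hf, hg, mul_add, Pi.single_add]⟩
    | monomial n a ha =>
      obtain ⟨f, hf⟩ := ha
      refine ⟨f * X ⟨p.1, hPW p.2⟩, ?_⟩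
      rw [map_mul, MulMemClass.coe_mul, hf, pointsHom_X_of_mem, ← Pi.single_mul, pow_succ]
      ring_nf
  intro f
  obtain ⟨c, hc⟩ := exists_pointsHom_eq_constantTuple hΓ ((f.1 o).coeff 0)
  choose g hg using fun p => hsingle p (f.1 p).divX
  refine ⟨c + ∑ p, g p, ?_⟩
  ext1
  rw [map_add, map_sum, hc, AddMemClass.coe_add, AddSubmonoidClass.coe_finsetSum,
    Finset.sum_congr rfl fun p _ => hg p]
  funext p
  rw [Pi.add_apply, Finset.sum_apply, Finset.sum_eq_single p
    (fun q _ hq => Pi.single_eq_of_ne hq.symm _) (fun h => absurd (Finset.mem_univ p) h),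
    Pi.single_eq_same, add_comm, f.2 o p]
  exact Polynomial.X_mul_divX_add (f.1 p)

theorem ker_pointsHom {Γ' : SComplex ℕ} (hPW : P ⊆ W) (o : {x // x ∈ P})
    (hΓ' : ∀ F, F ⊆ W → (F ∈ Γ'.faces ↔ F \ P ∈ Γ.faces ∧ (F ∩ P).card ≤ 1)) :
    RingHom.ker (pointsHom k W P Γ) = srIdealW k W Γ' := by
  refine le_antisymm (fun f hf => mem_srIdealW_iff.mpr fun e he heΓ' => ?_) ?_
  · have hmem := (hΓ' _ (exponentSupport_subset e)).mp heΓ'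
    obtain ⟨p, hp⟩ : ∃ p : {x // x ∈ P}, exponentSupport e ∩ P ⊆ {p.1} := by
      obtain h | ⟨a, ha⟩ := (exponentSupport e ∩ P).eq_empty_or_nonempty
      · exact ⟨o, by simp [h]⟩
      · exact ⟨⟨a, (Finset.mem_inter.mp ha).2⟩, fun b hb => Finset.mem_singleton.mpr
          (Finset.card_le_one.mp hmem.2 b hb a ha)⟩
    have hdisj : ∀ g ∈ srIdealW k W Γ,
        ((Ideal.Quotient.mk (srIdealW k W Γ')).comp (zeroVars k W P).toRingHom) g = 0 := by
      intro g hg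
      refine Ideal.Quotient.eq_zero_iff_mem.mpr (mem_srIdealW_iff.mpr fun d hd => ?_)
      have hd' : coeff d (zeroVars k W P g) ≠ 0 := mem_support_iff.mp hd
      rw [coeff_zeroVars] at hd'
      split_ifs at hd' with hdP
      · have := mem_srIdealW_iff.mp hg d (mem_support_iff.mpr hd')
        rw [hΓ' _ (exponentSupport_subset d), Finset.sdiff_eq_self_of_disjoint hdP]
        exact fun h => this h.1
      · exact absurd rfl hd'
    let θ : Polynomial (srRingW k W Γ) →+* srRingW k W Γ' :=
      Polynomial.eval₂RingHom (Ideal.Quotient.lift _ _ hdisj)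
        (Ideal.Quotient.mk _ (X ⟨p.1, hPW p.2⟩))
    have hθ : θ.comp (pointHom k W P Γ p).toRingHom =
        (Ideal.Quotient.mk (srIdealW k W Γ')).comp (zeroVars k W (P \ {p.1})).toRingHom := by
      refine MvPolynomial.ringHom_ext (fun r => ?_) fun w => ?_
      · have h1 : pointHom k W P Γ p (C r) = Polynomial.C (Ideal.Quotient.mk _ (C r)) :=
          (pointHom k W P Γ p).commutes r
        have h2 : ∀ Q, zeroVars k W Q (C r) = C r := fun Q => (zeroVars k W Q).commutes r
        simp [θ, h1, h2]
      · simp only [pointHom, pointVar, zeroVars, AlgHom.toRingHom_eq_coe, RingHom.coe_comp,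
          RingHom.coe_coe, Function.comp_apply, aeval_X, Finset.mem_sdiff, Finset.mem_singleton, θ]
        by_cases hwP : w.1 ∈ P
        · by_cases hwp : w.1 = p.1
          · simp [← hwp, hwP]
          · simp [hwP, hwp]
        · simp [hwP]
    have hf0 : pointHom k W P Γ p f = 0 := by
      rw [← pointsHom_apply, RingHom.mem_ker.mp hf]
      rfl
    have hmk : Ideal.Quotient.mk (srIdealW k W Γ') (zeroVars k W (P \ {p.1}) f) = 0 := by
      refine (DFunLike.congr_fun hθ f).symm.trans ?_
      change θ (pointHom k W P Γ p f) = 0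
      rw [hf0, map_zero]
    refine mem_srIdealW_iff.mp (Ideal.Quotient.eq_zero_iff_mem.mp hmk) e ?_ heΓ'
    rw [mem_support_iff, coeff_zeroVars, if_pos]
    · exact mem_support_iff.mp he
    · refine Finset.disjoint_left.mpr fun a ha haP => ?_
      rw [Finset.mem_sdiff] at haP
      exact haP.2 (hp (Finset.mem_inter.mpr ⟨ha, haP.1⟩))
  · rw [srIdealW, Ideal.span_le]
    rintro _ ⟨F, hFW, hF, rfl⟩
    refine RingHom.mem_ker.mpr ?_
    ext1
    funext p
    rw [pointsHom_apply]
    change pointHom k W P Γ p (monoW k W F) = 0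
    by_cases hFP : F \ P ∈ Γ.faces
    · have hcard : 1 < (F ∩ P).card := by
        by_contra hle
        exact hF ((hΓ' F hFW).mpr ⟨hFP, not_lt.mp hle⟩)
      obtain ⟨w, hw, hwp⟩ := Finset.exists_mem_ne hcard p.1
      rw [Finset.mem_inter] at hw
      have hw' : (⟨w, hFW hw.1⟩ : {x // x ∈ W}) ∈ F.subtype (· ∈ W) := Finset.mem_subtype.mpr hw.1
      have hdvd : X ⟨w, hFW hw.1⟩ ∣ monoW k W F := Finset.dvd_prod_of_mem _ hw'
      have h0 : pointHom k W P Γ p (X ⟨w, hFW hw.1⟩) = 0 := by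
        rw [pointHom, aeval_X, pointVar, if_pos hw.2, if_neg hwp]
      exact zero_dvd_iff.mp (h0 ▸ map_dvd (pointHom k W P Γ p) hdvd)
    · have hdvd : monoW k W (F \ P) ∣ monoW k W F :=
        Finset.prod_dvd_prod_of_subset _ _ _ fun w hw => by
          rw [Finset.mem_subtype] at hw ⊢
          exact Finset.sdiff_subset hw
      have h0 : pointHom k W P Γ p (monoW k W (F \ P)) =
          Polynomial.C (Ideal.Quotient.mk _ (monoW k W (F \ P))) := by
        simp only [monoW, map_prod]
        refine Finset.prod_congr rfl fun w hw => ?_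
        rw [Finset.mem_subtype, Finset.mem_sdiff] at hw
        rw [pointHom, aeval_X, pointVar, if_neg hw.2]
      rw [Ideal.Quotient.eq_zero_iff_mem.mpr
        ((monoW_mem_srIdealW_iff (Finset.sdiff_subset.trans hFW)).mpr hFP), map_zero] at h0
      exact zero_dvd_iff.mp (h0 ▸ map_dvd (pointHom k W P Γ p) hdvd)

theorem IsCMW.join_points {Γ' : SComplex ℕ} (hPW : P ⊆ W) (hP : P.Nonempty)
    (hΓ : ∀ F ∈ Γ.faces, Disjoint F P)
    (hΓ' : ∀ F, F ⊆ W → (F ∈ Γ'.faces ↔ F \ P ∈ Γ.faces ∧ (F ∩ P).card ≤ 1))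
    (h : IsCMW k W Γ) : IsCMW k W Γ' := by
  obtain ⟨o, ho⟩ := hP
  let e : srRingW k W Γ' ≃+* sharedConstant (srRingW k W Γ) {x // x ∈ P} :=
    (Ideal.quotEquivOfEq (ker_pointsHom hPW ⟨o, ho⟩ hΓ').symm).trans
      (RingHom.quotientKerEquivOfSurjective (pointsHom_surjective hPW ⟨o, ho⟩ hΓ))
  have he : ∀ f, e (Ideal.Quotient.mk _ f) = pointsHom k W P Γ f := fun _ => rfl
  have hsymm : ∀ f, e.symm (pointsHom k W P Γ f) = Ideal.Quotient.mk _ f := fun f => by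
    rw [← he, RingEquiv.symm_apply_apply]
  refine HasFullRegularSequence.of_ringEquiv e.symm (m := (srIrrelevantW k W Γ').comap e.symm)
    (fun r hr => hr) (HasFullRegularSequence.sharedConstant ⟨o, ho⟩ ?_ ?_ h)
  · have : variableTuple (srRingW k W Γ) {x // x ∈ P} =
        pointsHom k W P Γ (∑ p : {x // x ∈ P}, X ⟨p.1, hPW p.2⟩) := by
      ext1
      rw [map_sum, AddSubmonoidClass.coe_finsetSum,
        Finset.sum_congr rfl fun p _ => pointsHom_X_of_mem hPW p]
      exact (Finset.univ_sum_single
        fun _ : {x // x ∈ P} => (Polynomial.X : Polynomial (srRingW k W Γ))).symm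
    rw [this, Ideal.mem_comap, hsymm, map_sum]
    exact sum_mem fun p _ => mk_X_mem_srIrrelevantW k W Γ' _
  · suffices hle : srIrrelevantW k W Γ ≤ (srIrrelevantW k W Γ').comap
        ((e.symm : _ →+* _).comp (constantTuple (srRingW k W Γ) {x // x ∈ P})) from
      fun r hr => hle hr
    rw [srIrrelevantW, Ideal.map_le_iff_le_comap, Ideal.span_le]
    rintro _ ⟨w, rfl⟩
    change e.symm (constantTuple (srRingW k W Γ) {x // x ∈ P} (Ideal.Quotient.mk _ (X w))) ∈
      srIrrelevantW k W Γ'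
    by_cases hw : w.1 ∈ P
    · have : {w.1} ∉ Γ.faces := fun h => by simpa [hw] using hΓ _ h
      rw [Ideal.Quotient.eq_zero_iff_mem.mpr (X_mem_srIdealW this)]
      simp
    · rw [← pointsHom_X_of_notMem hw, hsymm]
      exact mk_X_mem_srIrrelevantW k W Γ' w

end JoinPoints

section Rainbow

theorem IsCMW.of_rainbow (k : Type*) [Field k] {W V : Finset ℕ} (hV : V ⊆ W) (c : ℕ → ℕ)
    {Γ : SComplex ℕ} (hΓ : ∀ F, F ∈ Γ.faces ↔ F ⊆ V ∧ Set.InjOn c F) : IsCMW k W Γ := by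
  induction V using Finset.strongInduction generalizing Γ with
  | H V ih =>
    obtain rfl | ⟨v, hv⟩ := V.eq_empty_or_nonempty
    · refine isCMW_of_faces_eq_singleton_empty k W fun F => ?_
      rw [hΓ, Finset.subset_empty]
      exact ⟨fun h => h.1, fun h => ⟨h, by simp [h]⟩⟩
    · let P := {x ∈ V | c x = c v}
      have hPV : P ⊆ V := Finset.filter_subset _ _
      have hvP : v ∈ P := Finset.mem_filter.mpr ⟨hv, rfl⟩
      let Γ₀ : SComplex ℕ :=
        { faces := {F | F ⊆ V \ P ∧ Set.InjOn c F}
          down_closed := fun F G hF hG =>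
            ⟨hG.trans hF.1, hF.2.mono (Finset.coe_subset.mpr hG)⟩ }
      refine IsCMW.join_points (Γ := Γ₀) (hPV.trans hV) ⟨v, hvP⟩
        (fun F hF => Finset.disjoint_of_subset_left hF.1 Finset.sdiff_disjoint) (fun F _ => ?_)
        (ih (V \ P) (Finset.sdiff_ssubset hPV ⟨v, hvP⟩) (Finset.sdiff_subset.trans hV)
          fun F => Iff.rfl)
      rw [hΓ]
      constructor
      · rintro ⟨hFV, hF⟩
        refine ⟨⟨Finset.sdiff_subset_sdiff hFV le_rfl, hF.mono (by simp)⟩,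
          Finset.card_le_one.mpr fun a ha b hb => ?_⟩
        rw [Finset.mem_inter, Finset.mem_filter] at ha hb
        exact hF ha.1 hb.1 (ha.2.2.trans hb.2.2.symm)
      · rintro ⟨⟨hFV, hF⟩, hcard⟩
        have hFV' : F ⊆ V := fun x hx => by
          by_cases hxP : x ∈ P
          · exact hPV hxP
          · exact (Finset.mem_sdiff.mp (hFV (Finset.mem_sdiff.mpr ⟨hx, hxP⟩))).1
        refine ⟨hFV', fun x hx y hy hxy => ?_⟩
        have hP : x ∈ P ↔ y ∈ P := by
          simp only [P, Finset.mem_filter, hFV' hx, hFV' hy, hxy]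
        by_cases hxP : x ∈ P
        · exact Finset.card_le_one.mp hcard x (Finset.mem_inter.mpr ⟨hx, hxP⟩) y
            (Finset.mem_inter.mpr ⟨hy, hP.mp hxP⟩)
        · exact hF (by simpa [hxP] using hx) (by simpa [← hP, hxP] using hy) hxy

theorem IsCMW.link_of_rainbow (k : Type*) [Field k] {W V : Finset ℕ} (hV : V ⊆ W) (c : ℕ → ℕ)
    {Γ : SComplex ℕ} (hΓ : ∀ F, F ∈ Γ.faces ↔ F ⊆ V ∧ Set.InjOn c F) {F : Finset ℕ}
    (hF : F ∈ Γ.faces) : IsCMW k W (Γ.link F) := by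
  refine IsCMW.of_rainbow k (V := {v ∈ V | c v ∉ F.image c}) ((Finset.filter_subset _ _).trans hV)
    c fun H => ?_
  rw [hΓ] at hF
  constructor
  · rintro ⟨hH, hdisj, hHF⟩
    rw [hΓ] at hH hHF
    refine ⟨fun x hx => Finset.mem_filter.mpr ⟨hH.1 hx, fun hxF => ?_⟩, hH.2⟩
    obtain ⟨y, hy, hyx⟩ := Finset.mem_image.mp hxF
    have := hHF.2 (Finset.mem_union_right H hy) (Finset.mem_union_left F hx) hyx
    exact Finset.disjoint_left.mp hdisj hx (this ▸ hy)
  · rintro ⟨hHV, hH⟩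
    have hnot : ∀ x ∈ H, ∀ y ∈ F, c x ≠ c y := fun x hx y hy h =>
      (Finset.mem_filter.mp (hHV hx)).2 (Finset.mem_image.mpr ⟨y, hy, h.symm⟩)
    have hHV' := hHV.trans (Finset.filter_subset _ _)
    refine ⟨(hΓ H).mpr ⟨hHV', hH⟩, Finset.disjoint_left.mpr fun x hx hxF => hnot x hx x hxF rfl,
      (hΓ _).mpr ⟨Finset.union_subset hHV' hF.1, ?_⟩⟩
    intro x hx y hy hxy
    simp only [Finset.coe_union, Set.mem_union, Finset.mem_coe] at hx hy
    obtain hx | hx := hx <;> obtain hy | hy := hy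
    · exact hH hx hy hxy
    · exact absurd hxy (hnot x hx y hy)
    · exact absurd hxy.symm (hnot y hy x hx)
    · exact hF.2 hx hy hxy

end Rainbow

namespace SComplex

theorem exists_isFacet_superset {Δ : SComplex ℕ} {W : Finset ℕ} (hW : ∀ F ∈ Δ.faces, F ⊆ W)
    {F : Finset ℕ} (hF : F ∈ Δ.faces) : ∃ G, Δ.IsFacet G ∧ F ⊆ G := by
  have hfin : Δ.faces.Finite := W.powerset.finite_toSet.subset fun G hG => by
    simpa using hW G hG
  obtain ⟨G, hFG, hG⟩ := hfin.exists_le_maximal hF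
  exact ⟨G, ⟨hG.prop, fun G' hG' hle => le_antisymm hle (hG.le_of_ge hG' hle)⟩, hFG⟩

theorem Pure.exists_superset_card_eq {Δ : SComplex ℕ} (hΔ : Δ.Pure) {W : Finset ℕ}
    (hW : ∀ F ∈ Δ.faces, F ⊆ W) {H : Finset ℕ} (hH : Δ.IsFacet H) {F : Finset ℕ}
    (hF : F ∈ Δ.faces) : ∃ G ∈ Δ.faces, F ⊆ G ∧ G.card = H.card := by
  obtain ⟨G, hG, hFG⟩ := exists_isFacet_superset hW hF
  exact ⟨G, hG.1, hFG, hΔ hG hH⟩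

theorem dimSucc_simplexOn (W : Finset ℕ) : (simplexOn W).dimSucc = W.card := by
  refine IsGreatest.csSup_eq ⟨⟨W, Finset.Subset.refl W, rfl⟩, ?_⟩
  rintro _ ⟨F, hF, rfl⟩
  exact Finset.card_le_card hF

end SComplex

section LexEdges

/-- For `a < b`, the condition that `x_a x_b` lies between `x_i x_j` and `x_r x_s`. -/
def IsLexEdge (i j r s a b : ℕ) : Prop :=
  (i < a ∨ a = i ∧ j ≤ b) ∧ (a < r ∨ a = r ∧ b ≤ s)

/-- A set containing no pair that lies between `x_i x_j` and `x_r x_s`. -/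
def IsLexFree (i j r s : ℕ) (F : Finset ℕ) : Prop :=
  ∀ a ∈ F, ∀ b ∈ F, a < b → ¬ IsLexEdge i j r s a b

theorem lexGT_pair_iff {a b c d : ℕ} (hab : a < b) (hcd : c < d) :
    lexGT {a, b} {c, d} ↔ a < c ∨ a = c ∧ b < d := by
  simp only [lexGT, Finset.mem_insert, Finset.mem_singleton, not_or]
  constructor
  · rintro ⟨m, hm, hmc, h⟩
    by_contra hcon
    have hc := h c
    have hd := h d
    have ha := h a
    omega
  · rintro (h | ⟨rfl, h⟩)
    · exact ⟨a, by omega, by omega, fun x hx => by omega⟩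
    · exact ⟨b, by omega, by omega, fun x hx => by omega⟩

theorem lexGE_pair_iff {a b c d : ℕ} (hab : a < b) (hcd : c < d) :
    lexGE {a, b} {c, d} ↔ a < c ∨ a = c ∧ b ≤ d := by
  rw [lexGE, lexGT_pair_iff hab hcd]
  constructor
  · rintro (h | h)
    · have ha : a ∈ ({c, d} : Finset ℕ) := h ▸ by simp
      have hb : b ∈ ({c, d} : Finset ℕ) := h ▸ by simp
      have hc : c ∈ ({a, b} : Finset ℕ) := h ▸ by simp
      simp only [Finset.mem_insert, Finset.mem_singleton] at ha hb hc
      omega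
    · omega
  · rintro (h | ⟨rfl, h⟩)
    · exact .inr (.inl h)
    · obtain rfl | h := h.eq_or_lt
      · exact .inl rfl
      · exact .inr (.inr ⟨rfl, h⟩)

variable {n i j r s : ℕ}

theorem mem_lexSegment_iff (hij : i < j) (hrs : r < s) {S : Finset ℕ} :
    S ∈ lexSegment n 2 {i, j} {r, s} ↔
      ∃ a b, a < b ∧ S = {a, b} ∧ S ⊆ Finset.Icc 1 n ∧ IsLexEdge i j r s a b := by
  constructor
  · rintro ⟨hSn, hcard, hU, hV⟩
    obtain ⟨a, b, hab, rfl⟩ : ∃ a b, a < b ∧ S = {a, b} := by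
      obtain ⟨a, b, hne, rfl⟩ := Finset.card_eq_two.mp hcard
      obtain h | h := hne.lt_or_gt
      · exact ⟨a, b, h, rfl⟩
      · exact ⟨b, a, h, Finset.pair_comm a b⟩
    rw [lexGE_pair_iff hij hab] at hU
    rw [lexGE_pair_iff hab hrs] at hV
    refine ⟨a, b, hab, rfl, hSn, ?_, hV⟩
    omega
  · rintro ⟨a, b, hab, rfl, hSn, h₁, h₂⟩
    refine ⟨hSn, Finset.card_pair hab.ne, (lexGE_pair_iff hij hab).mpr ?_,
      (lexGE_pair_iff hab hrs).mpr h₂⟩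
    omega

theorem IsLexFree.mono {F G : Finset ℕ} (hF : IsLexFree i j r s F) (hGF : G ⊆ F) :
    IsLexFree i j r s G :=
  fun a ha b hb => hF a (hGF ha) b (hGF hb)

theorem IsLexEdge.le {a b : ℕ} (h : IsLexEdge i j r s a b) : i ≤ a := by
  obtain ⟨h | h, -⟩ := h <;> omega

theorem isLexFree_of_filter {F : Finset ℕ} (hF : IsLexFree i j r s {x ∈ F | i ≤ x}) :
    IsLexFree i j r s F := fun a ha b hb hab h =>
  hF a (Finset.mem_filter.mpr ⟨ha, h.le⟩) b (Finset.mem_filter.mpr ⟨hb, h.le.trans hab.le⟩) hab h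

theorem mem_faces_iff_isLexFree {k : Type*} [Field k] (hij : i < j) (hrs : r < s) {a : ℕ}
    (ha : 1 ≤ a) (hai : a ≤ i) {Δ : SComplex ℕ} (hsub : ∀ F ∈ Δ.faces, F ⊆ Finset.Icc a n)
    (hΔ : srIdealW k (Finset.Icc a n) Δ = lexIdealW k (Finset.Icc a n) n 2 {i, j} {r, s})
    (F : Finset ℕ) : F ∈ Δ.faces ↔ F ⊆ Finset.Icc a n ∧ IsLexFree i j r s F := by
  suffices h : F ⊆ Finset.Icc a n → (F ∉ Δ.faces ↔ ¬ IsLexFree i j r s F) from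
    ⟨fun hF => ⟨hsub F hF, not_imp_not.mp (h (hsub F hF)).mpr hF⟩,
      fun hF => not_imp_not.mp (h hF.1).mp hF.2⟩
  intro hF
  rw [← monoW_mem_srIdealW_iff (k := k) hF, hΔ, lexIdealW, monoW_mem_span_monoW_iff,
    Finset.inter_eq_left.mpr hF]
  simp only [mem_lexSegment_iff hij hrs, IsLexFree]
  push Not
  constructor
  · rintro ⟨_, ⟨x, y, hxy, rfl, hn, hE⟩, hS⟩
    have hx := Finset.mem_Icc.mp (hn (Finset.mem_insert_self x {y}))
    have hy := Finset.mem_Icc.mp (hn (Finset.mem_insert_of_mem (Finset.mem_singleton_self y)))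
    have := hE.le
    exact ⟨x, hS (by simp; omega), y, hS (by simp; omega), hxy, hE⟩
  · rintro ⟨x, hx, y, hy, hxy, hE⟩
    have hsubF : ({x, y} : Finset ℕ) ⊆ F := by
      simp [Finset.insert_subset_iff, hx, hy]
    exact ⟨{x, y}, ⟨x, y, hxy, rfl, (hsubF.trans hF).trans (Finset.Icc_subset_Icc_left ha), hE⟩,
      Finset.inter_subset_left.trans hsubF⟩

end LexEdges

section LexsegmentComplex

variable {n i j r s : ℕ}

theorem card_le_two_or_of_pure (hij : i < j) (hrs : r < s) (hj : j ≤ n) (hs : s ≤ n)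
    (huv : i < r ∨ i = r ∧ j < s) {Δ : SComplex ℕ}
    (hΔ : ∀ F, F ∈ Δ.faces ↔ F ⊆ Finset.Icc i n ∧ IsLexFree i j r s F) (hpure : Δ.Pure) :
    (∀ F ∈ Δ.faces, F.card ≤ 2) ∨ r = i + 1 ∧ s = i + 2 ∧ j = n ∧ i + 4 ≤ n := by
  have hsub : ∀ F ∈ Δ.faces, F ⊆ Finset.Icc i n := fun F hF => ((hΔ F).mp hF).1
  have hvertex : ∀ a, i ≤ a → a ≤ n → {a} ∈ Δ.faces := by
    intro a hia han
    refine (hΔ _).mpr ⟨by simp [hia, han], fun x hx y hy hxy => ?_⟩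
    rw [Finset.mem_singleton] at hx hy
    omega
  have hedge : ∀ F ∈ Δ.faces, ∀ x ∈ F, ∀ y ∈ F, x < y → ¬ IsLexEdge i j r s x y :=
    fun F hF => ((hΔ F).mp hF).2
  have hmem : ∀ F ∈ Δ.faces, ∀ x ∈ F, i ≤ x ∧ x ≤ n :=
    fun F hF x hx => Finset.mem_Icc.mp (hsub F hF hx)
  simp only [IsLexEdge] at hedge
  obtain hir | ⟨rfl, hjs⟩ := huv
  · have hfacet : Δ.IsFacet (Finset.Icc (r + 1) n) := by
      refine ⟨(hΔ _).mpr ⟨Finset.Icc_subset_Icc_left (by omega), fun x hx y _ _ hE => ?_⟩,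
        fun G hG hle => Finset.Subset.antisymm hle fun x hx => ?_⟩
      · have := (Finset.mem_Icc.mp hx).1
        have := hE.2
        omega
      · by_contra hxI
        rw [Finset.mem_Icc] at hxI
        have := hmem G hG x hx
        have h₁ := hedge G hG x hx n (hle (by simp; omega)) (by omega)
        have h₂ := hedge G hG x hx s (hle (by simp; omega)) (by omega)
        omega
    have hext := fun F hF => hpure.exists_superset_card_eq hsub hfacet (F := F) hF
    simp only [Nat.card_Icc] at hext
    by_cases hd : n - r ≤ 2
    · left
      intro F hF
      obtain ⟨G, -, hFG, hG⟩ := hext F hF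
      have := Finset.card_le_card hFG
      omega
    · right
      have hr : r = i + 1 := by
        by_contra hr
        obtain ⟨G, hG, hiG, hcard⟩ := hext _ (hvertex (i + 1) (by omega) (by omega))
        have hGI : G ⊆ Finset.Icc i (i + 1) := fun y hy => by
          have := hmem G hG y hy
          have := hedge G hG (i + 1) (hiG (by simp)) y hy
          rw [Finset.mem_Icc]
          omega
        have := Finset.card_le_card hGI
        rw [Nat.card_Icc] at this
        omega
      have hs' : s = i + 2 := by
        obtain ⟨G, hG, hrG, hcard⟩ := hext _ (hvertex r (by omega) (by omega))
        have hrG := hrG (Finset.mem_singleton_self r)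
        by_cases hiG : i ∈ G
        · have hGI : G ⊆ {i, r} ∪ Finset.Icc (s + 1) (n - 1) := fun y hy => by
            have := hmem G hG y hy
            have := hedge G hG r hrG y hy
            have := hedge G hG i hiG y hy
            simp only [Finset.mem_union, Finset.mem_insert, Finset.mem_singleton, Finset.mem_Icc]
            omega
          have h₁ := Finset.card_le_card hGI
          have h₂ := Finset.card_union_le {i, r} (Finset.Icc (s + 1) (n - 1))
          have h₃ := Finset.card_le_two (a := i) (b := r)
          rw [Nat.card_Icc] at h₂
          omega
        · have hGI : G ⊆ {r} ∪ Finset.Icc (s + 1) n := fun y hy => by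
            have := hmem G hG y hy
            have := hedge G hG r hrG y hy
            have : y ≠ i := fun h => hiG (h ▸ hy)
            simp only [Finset.mem_union, Finset.mem_singleton, Finset.mem_Icc]
            omega
          have h₁ := Finset.card_le_card hGI
          have h₂ := Finset.card_union_le {r} (Finset.Icc (s + 1) n)
          rw [Nat.card_Icc, Finset.card_singleton] at h₂
          omega
      obtain ⟨G, hG, hiG, hcard⟩ := hext _ (hvertex i le_rfl (by omega))
      have hiG := hiG (Finset.mem_singleton_self i)
      have hGI : G ⊆ Finset.Icc i (j - 1) := fun y hy => by
        have := hmem G hG y hy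
        have := hedge G hG i hiG y hy
        rw [Finset.mem_Icc]
        omega
      have hlt : (j ≤ i + 2) ∨ G.card < (Finset.Icc i (j - 1)).card := by
        by_contra hcon
        rw [not_or, not_le, not_lt] at hcon
        have hG' := Finset.eq_of_subset_of_card_le hGI hcon.2
        have := hedge G hG (i + 1) (by rw [hG']; simp; omega) (i + 2) (by rw [hG']; simp; omega)
        omega
      have := Finset.card_le_card hGI
      rw [Nat.card_Icc] at this hlt
      omega
  · have hfacet : Δ.IsFacet (Finset.Icc (i + 1) n) := by
      refine ⟨(hΔ _).mpr ⟨Finset.Icc_subset_Icc_left (by omega), fun x hx y _ _ hE => ?_⟩,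
        fun G hG hle => Finset.Subset.antisymm hle fun x hx => ?_⟩
      · have := (Finset.mem_Icc.mp hx).1
        have := hE.2
        omega
      · by_contra hxI
        rw [Finset.mem_Icc] at hxI
        have := hmem G hG x hx
        have h₁ := hedge G hG x hx j (hle (by simp; omega)) (by omega)
        omega
    obtain ⟨G, hG, hiG, hcard⟩ :=
      hpure.exists_superset_card_eq hsub hfacet (hvertex i le_rfl (by omega))
    have hiG := hiG (Finset.mem_singleton_self i)
    have hGI : G ⊆ Finset.Icc i n \ Finset.Icc j s := fun y hy => by
      have := hmem G hG y hy
      have := hedge G hG i hiG y hy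
      rw [Finset.mem_sdiff, Finset.mem_Icc, Finset.mem_Icc]
      omega
    have h₁ := Finset.card_le_card hGI
    rw [Finset.card_sdiff_of_subset (Finset.Icc_subset_Icc hij.le hs)] at h₁
    simp only [Nat.card_Icc] at h₁ hcard
    omega

theorem isCMW_link_of_card_le_two (k : Type*) [Field k] {a : ℕ} {Δ : SComplex ℕ}
    (hΔ : ∀ F, F ∈ Δ.faces ↔ F ⊆ Finset.Icc a n ∧ IsLexFree i j r s F)
    (hcard : ∀ F ⊆ Finset.Icc i n, IsLexFree i j r s F → F.card ≤ 2)
    {F : Finset ℕ} (hF : F ∈ Δ.faces) {g : ℕ} (hg : g ∈ F) (hig : i ≤ g) :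
    IsCMW k (Finset.Icc a n) (Δ.link F) := by
  classical
  refine IsCMW.of_rainbow k
    (V := {w ∈ Finset.Icc a n | w ∉ F ∧ IsLexFree i j r s (insert w F)})
    (Finset.filter_subset _ _) (fun x => if i ≤ x then i else x) fun H => ?_
  have hFI := ((hΔ F).mp hF).1
  constructor
  · rintro ⟨-, hdisj, hHF⟩
    rw [hΔ] at hHF
    refine ⟨fun w hw => Finset.mem_filter.mpr ⟨hHF.1 (Finset.mem_union_left F hw),
      Finset.disjoint_left.mp hdisj hw, hHF.2.mono ?_⟩, fun x hx y hy hxy => ?_⟩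
    · exact Finset.insert_subset (Finset.mem_union_left F hw) Finset.subset_union_right
    · by_contra hne
      rw [Finset.mem_coe] at hx hy
      dsimp only at hxy
      have hxi : i ≤ x ∧ i ≤ y := by
        split_ifs at hxy <;> omega
      have hsub : ({x, y, g} : Finset ℕ) ⊆ H ∪ F := by
        simp [Finset.insert_subset_iff, hx, hy, hg]
      have hle : ({x, y, g} : Finset ℕ).card ≤ 2 := by
        refine hcard _ (fun z hz => ?_) (hHF.2.mono hsub)
        have := Finset.mem_Icc.mp (hHF.1 (hsub hz))
        simp only [Finset.mem_insert, Finset.mem_singleton] at hz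
        rw [Finset.mem_Icc]
        omega
      have hxg : x ≠ g := fun h => Finset.disjoint_left.mp hdisj hx (h ▸ hg)
      have hyg : y ≠ g := fun h => Finset.disjoint_left.mp hdisj hy (h ▸ hg)
      rw [Finset.card_eq_three.mpr ⟨x, y, g, hne, hxg, hyg, rfl⟩] at hle
      omega
  · rintro ⟨hHV, hinj⟩
    have hH : ∀ w ∈ H, w ∈ Finset.Icc a n ∧ w ∉ F ∧ IsLexFree i j r s (insert w F) :=
      fun w hw => Finset.mem_filter.mp (hHV hw)
    have hHF : H ∪ F ∈ Δ.faces := by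
      refine (hΔ _).mpr ⟨Finset.union_subset (fun w hw => (hH w hw).1) hFI,
        fun x hx y hy hxy hE => ?_⟩
      rw [Finset.mem_union] at hx hy
      obtain hx | hx := hx <;> obtain hy | hy := hy
      · refine hxy.ne (hinj hx hy ?_)
        have := hE.le
        dsimp only
        rw [if_pos this, if_pos (by omega)]
      · exact (hH x hx).2.2 x (by simp) y (by simp [hy]) hxy hE
      · exact (hH y hy).2.2 x (by simp [hx]) y (by simp) hxy hE
      · exact ((hΔ F).mp hF).2 x hx y hy hxy hE
    exact ⟨Δ.down_closed hHF Finset.subset_union_left,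
      Finset.disjoint_left.mpr fun w hw => (hH w hw).2.1, hHF⟩

theorem isCMW_link (k : Type*) [Field k] {a : ℕ} {Δ : SComplex ℕ}
    (hΔ : ∀ F, F ∈ Δ.faces ↔ F ⊆ Finset.Icc a n ∧ IsLexFree i j r s F)
    (h : (∀ F ⊆ Finset.Icc i n, IsLexFree i j r s F → F.card ≤ 2) ∨
      r = i + 1 ∧ s = i + 2 ∧ j = n ∧ i + 4 ≤ n)
    {F : Finset ℕ} (hF : F ∈ Δ.faces) {g : ℕ} (hg : g ∈ F) (hig : i ≤ g) :
    IsCMW k (Finset.Icc a n) (Δ.link F) := by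
  obtain h | ⟨rfl, rfl, rfl, hn⟩ := h
  · exact isCMW_link_of_card_le_two k hΔ h hF hg hig
  · refine IsCMW.link_of_rainbow k le_rfl
      (fun x => if x = j then i else if x = i + 2 then i + 1 else x) (fun G => ?_) hF
    rw [hΔ]
    refine and_congr_right fun hG => ⟨fun hfree x hx y hy hxy => ?_,
      fun hinj x hx y hy hxy hE => ?_⟩
    · have h₁ := hfree x hx y hy
      have h₂ := hfree y hy x hx
      simp only [IsLexEdge] at h₁ h₂
      dsimp only at hxy
      split_ifs at hxy <;> omega
    · refine hxy.ne (hinj hx hy ?_)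
      have := Finset.mem_Icc.mp (hG hy)
      simp only [IsLexEdge] at hE
      dsimp only
      split_ifs <;> omega

theorem isLexFree_union_iff {F : Finset ℕ} :
    IsLexFree i j r s (Finset.Icc 1 (i - 1) ∪ F) ↔ IsLexFree i j r s F := by
  refine ⟨fun h => h.mono Finset.subset_union_right, fun h => isLexFree_of_filter (h.mono ?_)⟩
  intro x hx
  simp only [Finset.mem_filter, Finset.mem_union, Finset.mem_Icc] at hx
  obtain ⟨h | h, hix⟩ := hx
  · omega
  · exact h

theorem isFacet_union_of_isFacet {Δ Δ₂ : SComplex ℕ}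
    (hΔ : ∀ F, F ∈ Δ.faces ↔ F ⊆ Finset.Icc 1 n ∧ IsLexFree i j r s F)
    (hΔ₂ : ∀ F, F ∈ Δ₂.faces ↔ F ⊆ Finset.Icc i n ∧ IsLexFree i j r s F)
    (hi : 1 ≤ i) (hin : i ≤ n) {G : Finset ℕ} (hG : Δ₂.IsFacet G) :
    Δ.IsFacet (Finset.Icc 1 (i - 1) ∪ G) := by
  have hG₂ := (hΔ₂ G).mp hG.1
  refine ⟨(hΔ _).mpr ⟨Finset.union_subset (Finset.Icc_subset_Icc_right (by omega))
    (hG₂.1.trans (Finset.Icc_subset_Icc_left hi)), isLexFree_union_iff.mpr hG₂.2⟩,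
    fun F hF hle => Finset.Subset.antisymm hle fun x hx => ?_⟩
  rw [hΔ] at hF
  have hFG : G = {x ∈ F | i ≤ x} := by
    refine hG.2 _ ((hΔ₂ _).mpr ⟨fun y hy => ?_, hF.2.mono (Finset.filter_subset _ _)⟩)
      fun y hy => Finset.mem_filter.mpr ⟨hle (Finset.mem_union_right _ hy),
        (Finset.mem_Icc.mp (hG₂.1 hy)).1⟩
    rw [Finset.mem_filter] at hy
    exact Finset.mem_Icc.mpr ⟨hy.2, (Finset.mem_Icc.mp (hF.1 hy.1)).2⟩
  have := Finset.mem_Icc.mp (hF.1 hx)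
  rw [Finset.mem_union, Finset.mem_Icc, hFG, Finset.mem_filter]
  by_cases hix : i ≤ x
  · exact .inr ⟨hx, hix⟩
  · exact .inl (by omega)

theorem exists_isFacet_of_isFacet {Δ Δ₂ : SComplex ℕ}
    (hΔ : ∀ F, F ∈ Δ.faces ↔ F ⊆ Finset.Icc 1 n ∧ IsLexFree i j r s F)
    (hΔ₂ : ∀ F, F ∈ Δ₂.faces ↔ F ⊆ Finset.Icc i n ∧ IsLexFree i j r s F)
    (hi : 1 ≤ i) (hin : i ≤ n) {F : Finset ℕ} (hF : Δ.IsFacet F) :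
    ∃ G, Δ₂.IsFacet G ∧ F = Finset.Icc 1 (i - 1) ∪ G := by
  have hF₁ := (hΔ F).mp hF.1
  have hface : {x ∈ F | i ≤ x} ∈ Δ₂.faces := by
    refine (hΔ₂ _).mpr ⟨fun y hy => ?_, hF₁.2.mono (Finset.filter_subset _ _)⟩
    rw [Finset.mem_filter] at hy
    exact Finset.mem_Icc.mpr ⟨hy.2, (Finset.mem_Icc.mp (hF₁.1 hy.1)).2⟩
  obtain ⟨G, hG, hle⟩ :=
    SComplex.exists_isFacet_superset (fun F hF => ((hΔ₂ F).mp hF).1) hface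
  refine ⟨G, hG, hF.2 _ (isFacet_union_of_isFacet hΔ hΔ₂ hi hin hG).1 fun x hx => ?_⟩
  have := Finset.mem_Icc.mp (hF₁.1 hx)
  rw [Finset.mem_union, Finset.mem_Icc]
  by_cases hix : i ≤ x
  · exact .inr (hle (Finset.mem_filter.mpr ⟨hx, hix⟩))
  · exact .inl (by omega)

theorem pure_iff_pure {Δ Δ₂ : SComplex ℕ}
    (hΔ : ∀ F, F ∈ Δ.faces ↔ F ⊆ Finset.Icc 1 n ∧ IsLexFree i j r s F)
    (hΔ₂ : ∀ F, F ∈ Δ₂.faces ↔ F ⊆ Finset.Icc i n ∧ IsLexFree i j r s F)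
    (hi : 1 ≤ i) (hin : i ≤ n) : Δ.Pure ↔ Δ₂.Pure := by
  have hcard : ∀ G, Δ₂.IsFacet G → (Finset.Icc 1 (i - 1) ∪ G).card = i - 1 + G.card := by
    intro G hG
    rw [Finset.card_union_of_disjoint, Nat.card_Icc, Nat.add_sub_cancel]
    refine Finset.disjoint_left.mpr fun x hx hxG => ?_
    have h₁ := Finset.mem_Icc.mp hx
    have h₂ := Finset.mem_Icc.mp (((hΔ₂ G).mp hG.1).1 hxG)
    omega
  constructor
  · intro h F G hF hG
    have := h (isFacet_union_of_isFacet hΔ hΔ₂ hi hin hF)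
      (isFacet_union_of_isFacet hΔ hΔ₂ hi hin hG)
    rwa [hcard F hF, hcard G hG, Nat.add_left_cancel_iff] at this
  · intro h F G hF hG
    obtain ⟨F', hF', rfl⟩ := exists_isFacet_of_isFacet hΔ hΔ₂ hi hin hF
    obtain ⟨G', hG', rfl⟩ := exists_isFacet_of_isFacet hΔ hΔ₂ hi hin hG
    rw [hcard F' hF', hcard G' hG', h hF' hG']

theorem isCMW_link_of_insert {k : Type*} [Field k] {Δ : SComplex ℕ}
    (hΔ : ∀ F, F ∈ Δ.faces ↔ F ⊆ Finset.Icc 1 n ∧ IsLexFree i j r s F)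
    (hin : i ≤ n) {F : Finset ℕ} {a : ℕ}
    (ha : 1 ≤ a) (hai : a < i) (haF : a ∉ F)
    (h : IsCMW k (Finset.Icc 1 n) (Δ.link (insert a F))) :
    IsCMW k (Finset.Icc 1 n) (Δ.link F) := by
  have hinsert : ∀ {H}, H ∈ Δ.faces → insert a H ∈ Δ.faces := by
    intro H hH
    rw [hΔ] at hH ⊢
    refine ⟨Finset.insert_subset (by simp; omega) hH.1,
      isLexFree_of_filter (hH.2.mono fun x hx => ?_)⟩
    rw [Finset.mem_filter, Finset.mem_insert] at hx
    exact hx.1.resolve_left (by omega)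
  refine h.join_points (P := {a}) (by simp; omega) (Finset.singleton_nonempty a)
    (fun H hH => ?_) fun H _ => ⟨?_, ?_⟩
  · exact Finset.disjoint_of_subset_right (by simp) hH.2.1
  · rintro ⟨hH, hdisj, hHF⟩
    refine ⟨⟨Δ.down_closed hH Finset.sdiff_subset, ?_, Δ.down_closed (hinsert hHF) ?_⟩,
      (Finset.card_le_card Finset.inter_subset_right).trans (by simp)⟩
    · rw [Finset.disjoint_insert_right]
      exact ⟨by simp, Finset.disjoint_of_subset_left Finset.sdiff_subset hdisj⟩
    · intro x
      simp only [Finset.mem_union, Finset.mem_sdiff, Finset.mem_insert, Finset.mem_singleton]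
      tauto
  · rintro ⟨⟨-, hdisj, hHF⟩, -⟩
    have hHF' : H ∪ F ∈ Δ.faces := Δ.down_closed hHF fun x => by
      simp only [Finset.mem_union, Finset.mem_sdiff, Finset.mem_insert, Finset.mem_singleton]
      tauto
    refine ⟨Δ.down_closed hHF' Finset.subset_union_left, ?_, hHF'⟩
    refine Finset.disjoint_left.mpr fun x hx hxF => ?_
    refine Finset.disjoint_left.mp hdisj (Finset.mem_sdiff.mpr ⟨hx, ?_⟩)
      (Finset.mem_insert_of_mem hxF)
    rw [Finset.mem_singleton]
    exact fun h => haF (h ▸ hxF)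

end LexsegmentComplex

/-- Let `u = xᵢxⱼ > v = xᵣxₛ`, `Δ` the associated lexsegment
complex, `Δ₁` the full simplex on `{1, …, i-1}`, `Δ₂` the complex of the
lexsegment ideal in `k[xᵢ, …, xₙ]`, and `t ≥ 2`; assume `Δ` is not `CM_{t-1}`
over `k`. Then `Δ` is `CM_t` over `k` iff `Δ₁` has dimension `t - 2`
(i.e. `i = t`) and `Δ₂` is Buchsbaum over `k`. -/
theorem lexsegment_CMt_iff_buchsbaum (k : Type*) [Field k] (n i j r s : ℕ) (hij : i < j) (hrs : r < s)
    (hUsub : ({i, j} : Finset ℕ) ⊆ Finset.Icc 1 n)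
    (hVsub : ({r, s} : Finset ℕ) ⊆ Finset.Icc 1 n)
    (huv : lexGT {i, j} {r, s})
    (Δ : SComplex ℕ) (hΔsub : ∀ F ∈ Δ.faces, F ⊆ Finset.Icc 1 n)
    (hΔ : srIdealW k (Finset.Icc 1 n) Δ = lexIdealW k (Finset.Icc 1 n) n 2 {i, j} {r, s})
    (Δ₂ : SComplex ℕ) (hΔ₂sub : ∀ F ∈ Δ₂.faces, F ⊆ Finset.Icc i n)
    (hΔ₂ : srIdealW k (Finset.Icc i n) Δ₂ = lexIdealW k (Finset.Icc i n) n 2 {i, j} {r, s})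
    (t : ℕ) (ht : 2 ≤ t)
    (hN : ¬ IsCMtW k (Finset.Icc 1 n) (t - 1) Δ) :
    IsCMtW k (Finset.Icc 1 n) t Δ ↔
      ((SComplex.simplexOn (Finset.Icc 1 (i - 1)) : SComplex ℕ).dimSucc = t - 1 ∧
        IsCMtW k (Finset.Icc i n) 1 Δ₂) := by
  simp only [Finset.insert_subset_iff, Finset.singleton_subset_iff, Finset.mem_Icc] at hUsub hVsub
  rw [lexGT_pair_iff hij hrs] at huv
  have hi : 1 ≤ i := hUsub.1.1
  have hin : i ≤ n := hUsub.1.2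
  have hΔ' := mem_faces_iff_isLexFree hij hrs le_rfl hi hΔsub hΔ
  have hΔ₂' := mem_faces_iff_isLexFree hij hrs hi le_rfl hΔ₂sub hΔ₂
  have hpure := pure_iff_pure hΔ' hΔ₂' hi hin
  have hcases : Δ₂.Pure → (∀ F ⊆ Finset.Icc i n, IsLexFree i j r s F → F.card ≤ 2) ∨
      r = i + 1 ∧ s = i + 2 ∧ j = n ∧ i + 4 ≤ n := fun h =>
    (card_le_two_or_of_pure hij hrs hUsub.2.2 hVsub.2.2 huv hΔ₂' h).imp_left
      fun h' F hF hfree => h' F ((hΔ₂' F).mpr ⟨hF, hfree⟩)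
  rw [SComplex.dimSucc_simplexOn, Nat.card_Icc, Nat.add_sub_cancel]
  constructor
  · intro hCM
    have hΔ₂pure := hpure.mp hCM.1
    refine ⟨?_, hΔ₂pure, fun F hF hcard => ?_⟩
    · simp only [IsCMtW, not_and, not_forall] at hN
      obtain ⟨F, hF, hcard, hlink⟩ := hN hCM.1
      have hFt : F.card = t - 1 := by
        by_contra hne
        exact hlink (hCM.2 F hF (by omega))
      have hlow : F ⊆ Finset.Icc 1 (i - 1) := fun x hx => by
        have := Finset.mem_Icc.mp (hΔsub F hF hx)
        have : ¬ i ≤ x := fun hix => hlink (isCMW_link k hΔ' (hcases hΔ₂pure) hF hx hix)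
        exact Finset.mem_Icc.mpr (by omega)
      have hle : Finset.Icc 1 (i - 1) ⊆ F := fun a ha => by
        rw [Finset.mem_Icc] at ha
        by_contra haF
        refine hlink (isCMW_link_of_insert hΔ' hin ha.1 (by omega) haF (hCM.2 _ ?_ ?_))
        · refine (hΔ' _).mpr ⟨Finset.insert_subset (by simp; omega) (hΔsub F hF), ?_⟩
          refine isLexFree_of_filter fun x hx => ?_
          rw [Finset.mem_filter, Finset.mem_insert] at hx
          obtain ⟨rfl | hxF, hix⟩ := hx
          · omega
          · have := Finset.mem_Icc.mp (hlow hxF)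
            omega
        · rw [Finset.card_insert_of_notMem haF]
          omega
      rw [← hFt, Finset.Subset.antisymm hlow hle, Nat.card_Icc, Nat.add_sub_cancel]
    · obtain ⟨g, hg⟩ := Finset.card_pos.mp hcard
      exact isCMW_link k hΔ₂' (hcases hΔ₂pure) hF hg
        (Finset.mem_Icc.mp (hΔ₂sub F hF hg)).1
  · rintro ⟨hit, hCM⟩
    refine ⟨hpure.mpr hCM.1, fun F hF hcard => ?_⟩
    obtain ⟨g, hg, hig⟩ : ∃ g ∈ F, i ≤ g := by
      by_contra! hcon
      have hle : F ⊆ Finset.Icc 1 (i - 1) := fun x hx => by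
        have := Finset.mem_Icc.mp (hΔsub F hF hx)
        have := hcon x hx
        exact Finset.mem_Icc.mpr (by omega)
      have := Finset.card_le_card hle
      rw [Nat.card_Icc] at this
      omega
    exact isCMW_link k hΔ' (hcases hCM.1) hF hg hig
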